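/- arXiv:2208.11987 — 3 statements merged into one kernel-verified Lean document; each statement's English description precedes it below -/
import Mathlib

section
/- Let X be a real Banach space which is an ℓ₁-predual, i.e. there is an isometric linear isomorphism from ℓ₁ (the space of absolutely summable real sequences) onto the dual X*. Then the set BSa(X,ℝ) of bounded linear functionals on X having the adjusted Bhatia-Šemrl property is dense in X* with respect to the weak-* topology. -/
open scoped BigOperators

section Defs

variable {E : Type*} [NormedAddCommGroup E] [NormedSpace ℝ E]

/-- Birkhoff-James orthogonality: `x ⊥_B y` iff `‖x‖ ≤ ‖x + t • y‖` for all real `t`. -/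
def BJOrth (x y : E) : Prop := ∀ t : ℝ, ‖x‖ ≤ ‖x + t • y‖

/-- Strong Birkhoff-James orthogonality: `x ⊥_S y` iff `‖x‖ < ‖x + t • y‖` for all real `t ≠ 0`. -/
def SBJOrth (x y : E) : Prop := ∀ t : ℝ, t ≠ 0 → ‖x‖ < ‖x + t • y‖

variable {X Y : Type*} [NormedAddCommGroup X] [NormedSpace ℝ X]
  [NormedAddCommGroup Y] [NormedSpace ℝ Y]

/-- A bounded linear operator attains its norm. -/
def NormAttaining (T : X →L[ℝ] Y) : Prop := ∃ x : X, ‖x‖ = 1 ∧ ‖T x‖ = ‖T‖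

/-- The adjusted Bhatia-Šemrl property. -/
def HasBSa (T : X →L[ℝ] Y) : Prop :=
  NormAttaining T ∧ ∀ S : X →L[ℝ] Y, SBJOrth T S →
    ∃ x : X, ‖x‖ = 1 ∧ ‖T x‖ = ‖T‖ ∧ BJOrth (T x) (S x)

/-- The Bhatia-Šemrl property. -/
def HasBS (T : X →L[ℝ] Y) : Prop :=
  NormAttaining T ∧ ∀ S : X →L[ℝ] Y, BJOrth T S →
    ∃ x : X, ‖x‖ = 1 ∧ ‖T x‖ = ‖T‖ ∧ BJOrth (T x) (S x)

end Defs

/-- The space `ℓ₁`. -/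
abbrev EllOne : Type := lp (fun _ : ℕ => ℝ) 1

/-- The tail of an `ℓ₁` sequence. -/
noncomputable def ellTail (N : ℕ) (b : EllOne) : EllOne :=
  b - ∑ i ∈ Finset.range N, lp.single 1 i (b i)

theorem ellTail_apply (N : ℕ) (b : EllOne) (j : ℕ) :
    ellTail N b j = if j < N then 0 else b j := by
  unfold ellTail
  rw [lp.coeFn_sub, Pi.sub_apply, lp.coeFn_sum, Finset.sum_apply]
  simp only [lp.single_apply, Finset.sum_pi_single, Finset.mem_range]
  split_ifs <;> simp

theorem norm_split (N : ℕ) (b : EllOne) :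
    ‖b‖ = ∑ i ∈ Finset.range N, |b i| + ‖ellTail N b‖ := by
  have h := lp.norm_sub_norm_compl_sub_single (p := 1) (by simp) b (Finset.range N)
  simp only [ENNReal.toReal_one, Real.rpow_one, Real.norm_eq_abs] at h
  unfold ellTail
  linarith

theorem ellTail_tendsto (b : EllOne) :
    Filter.Tendsto (fun N => ∑ i ∈ Finset.range N, lp.single 1 i (b i)) Filter.atTop
      (nhds b) :=
  (lp.hasSum_single (p := 1) (by simp) b).tendsto_sum_nat

theorem ellTail_small (b : EllOne) {ε : ℝ} (hε : 0 < ε) (N₀ : ℕ) :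
    ∃ N, N₀ ≤ N ∧ ‖ellTail N b‖ < ε := by
  have h := (Metric.tendsto_atTop.1 (ellTail_tendsto b)) ε hε
  obtain ⟨N, hN⟩ := h
  refine ⟨max N N₀, le_max_right _ _, ?_⟩
  have := hN (max N N₀) (le_max_left _ _)
  rw [dist_eq_norm, norm_sub_rev] at this
  exact this

theorem bound_of_ball {X : Type*} [NormedAddCommGroup X] [NormedSpace ℝ X]
    (m : X →L[ℝ] ℝ) {A B : ℝ} (hA : 0 < A) (h : ∀ u : X, ‖u‖ < A → m u ≤ B) :
    A * ‖m‖ ≤ B := by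
  by_contra hc
  push Not at hc
  have h1 : B / A < ‖m‖ := by rw [div_lt_iff₀ hA]; linarith
  obtain ⟨x, hx, hx'⟩ := m.exists_lt_apply_of_lt_opNorm h1
  rw [div_lt_iff₀ hA, Real.norm_eq_abs] at hx'
  have hn : ‖A • x‖ < A := by
    rw [norm_smul, Real.norm_eq_abs, abs_of_pos hA]; nlinarith
  have h2 := h (A • x) hn
  have h3 := h (-(A • x)) (by rwa [norm_neg])
  simp only [map_neg, map_smul, smul_eq_mul] at h2 h3
  rcases abs_cases (m x) with h4 | h4 <;> rw [h4.1] at hx' <;> nlinarith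

section Predual

variable {X : Type*} [NormedAddCommGroup X] [NormedSpace ℝ X]
  (φ : EllOne ≃ₗᵢ[ℝ] (X →L[ℝ] ℝ))

/-- The functionals corresponding to the unit vectors. -/
noncomputable def coordF (i : ℕ) : X →L[ℝ] ℝ := φ (lp.single 1 i (1 : ℝ))

theorem phi_single (i : ℕ) (c : ℝ) (x : X) :
    φ (lp.single 1 i c) x = c * coordF φ i x := by
  have : (lp.single 1 i c : EllOne) = c • lp.single 1 i (1 : ℝ) := by
    rw [← lp.single_smul]; simp
  rw [this, map_smul]; rfl

theorem phi_split (N : ℕ) (b : EllOne) (x : X) :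
    φ b x = ∑ i ∈ Finset.range N, b i * coordF φ i x + φ (ellTail N b) x := by
  have : b = ∑ i ∈ Finset.range N, lp.single 1 i (b i) + ellTail N b := by
    unfold ellTail; abel
  conv_lhs => rw [this, map_add, map_sum]
  simp only [add_apply, sum_apply, phi_single]

theorem phi_le (b : EllOne) (x : X) : |φ b x| ≤ ‖b‖ * ‖x‖ := by
  have := (φ b).le_opNorm x
  rwa [φ.norm_map] at this

theorem exists_interp (N : ℕ) (s : ℕ → ℝ) : ∃ x : X, ∀ i < N, coordF φ i x = s i := by
  let T : X →ₗ[ℝ] (Fin N → ℝ) := LinearMap.pi fun i => (coordF φ i : X →ₗ[ℝ] ℝ)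
  by_cases hT : LinearMap.range T = ⊤
  · obtain ⟨x, hx⟩ := (LinearMap.range_eq_top.1 hT) (fun i => s i)
    exact ⟨x, fun i hi => congrFun hx ⟨i, hi⟩⟩
  · exfalso
    obtain ⟨f, hf0, hf⟩ := Submodule.exists_le_ker_of_lt_top _ (lt_top_iff_ne_top.2 hT)
    apply hf0
    let c : Fin N → ℝ := fun i => f (Pi.single i 1)
    have hfv : ∀ v, f v = ∑ i, v i * c i := by
      intro v
      conv_lhs => rw [pi_eq_sum_univ' v]
      simp [map_sum, c]
    have h0 : φ (∑ i : Fin N, lp.single 1 (i : ℕ) (c i)) = 0 := by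
      ext x
      have h1 : f (T x) = 0 := hf ⟨x, rfl⟩
      rw [hfv] at h1
      rw [map_sum, sum_apply]
      simp only [phi_single]
      rw [zero_apply, ← h1]
      refine Finset.sum_congr rfl fun i _ => ?_
      simp [T, mul_comm]
    have h1 := (map_eq_zero_iff φ φ.injective).1 h0
    have hc : ∀ i, c i = 0 := by
      intro i
      have h2 := congrArg (fun b : EllOne => b (i : ℕ)) h1
      simp only [lp.coeFn_sum, Finset.sum_apply, lp.single_apply, Pi.single_apply] at h2
      simpa [Fin.val_inj] using h2
    ext i
    simpa [c] using hc i

theorem tail_zero_of_ker (N : ℕ) (b : EllOne)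
    (h : ∀ k : X, (∀ i < N, coordF φ i k = 0) → φ b k = 0) : ellTail N b = 0 := by
  have hw : ∀ j : ℕ, ∃ w : X, ∀ i < N, coordF φ i w = if i = j then 1 else 0 :=
    fun j => exists_interp φ N _
  choose w hw using hw
  have h1 : b = ∑ j ∈ Finset.range N, lp.single 1 j (φ b (w j)) := by
    apply φ.injective
    ext y
    rw [map_sum, sum_apply]
    simp only [phi_single]
    have := h (y - ∑ j ∈ Finset.range N, coordF φ j y • w j) (by
      intro i hi
      simp only [map_sub, map_sum, map_smul, smul_eq_mul, hw _ i hi]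
      simp [hi])
    simp only [map_sub, map_sum, map_smul, smul_eq_mul] at this
    rw [sub_eq_zero.1 this]
    exact Finset.sum_congr rfl fun i _ => mul_comm _ _
  ext j
  rw [ellTail_apply]
  split_ifs with hj
  · rfl
  · rw [h1]
    simp only [lp.coeFn_sum, Finset.sum_apply, lp.single_apply, Finset.sum_pi_single,
      Finset.mem_range, hj, if_false]
    rfl

theorem ellTail_add (N : ℕ) (b c : EllOne) :
    ellTail N (b + c) = ellTail N b + ellTail N c := by
  ext j
  simp only [ellTail_apply, lp.coeFn_add, Pi.add_apply]
  split_ifs <;> simp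

/-- The improvement step. -/
theorem interp_step (N : ℕ) (s : ℕ → ℝ) (hs : ∀ i, |s i| ≤ 1) (x : X)
    (hx : ∀ i < N, coordF φ i x = s i) {ε ε' : ℝ} (hε : 0 < ε) (hε' : 0 < ε')
    (hxn : ‖x‖ ≤ 1 + ε) :
    ∃ y : X, (∀ i < N, coordF φ i y = s i) ∧ ‖y‖ ≤ 1 + ε' ∧ ‖y - x‖ ≤ ε := by
  by_contra hcon
  push Not at hcon
  let U : Set (X × X) := Metric.ball 0 (1 + ε') ×ˢ Metric.ball x ε
  let L : Set (X × X) := {p | p.1 = p.2 ∧ ∀ i < N, coordF φ i p.1 = s i}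
  have hUc : Convex ℝ U := (convex_ball _ _).prod (convex_ball _ _)
  have hUo : IsOpen U := Metric.isOpen_ball.prod Metric.isOpen_ball
  have hL : Convex ℝ L := by
    rintro ⟨p, p'⟩ ⟨hp, hp1⟩ ⟨q, q'⟩ ⟨hq, hq1⟩ a b ha hb hab
    simp only at hp hq hp1 hq1
    subst hp hq
    refine ⟨rfl, fun i hi => ?_⟩
    simp only [Prod.smul_mk, Prod.mk_add_mk, map_add, map_smul, smul_eq_mul, hp1 i hi, hq1 i hi]
    rw [← add_mul, hab, one_mul]
  have hd : Disjoint U L := by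
    rw [Set.disjoint_left]
    rintro ⟨p, p'⟩ ⟨hp, hp'⟩ ⟨h1, h2⟩
    simp only at h1 h2 hp hp'
    subst h1
    rw [mem_ball_zero_iff] at hp
    rw [mem_ball_iff_norm] at hp'
    exact absurd hp'.le (not_le.2 (hcon p h2 hp.le))
  obtain ⟨F, c, hF1, hF2⟩ := geometric_hahn_banach_open hUc hUo hL hd
  let m1 : X →L[ℝ] ℝ := F.comp (ContinuousLinearMap.inl ℝ X X)
  let m2 : X →L[ℝ] ℝ := F.comp (ContinuousLinearMap.inr ℝ X X)
  have hFm : ∀ u v, F (u, v) = m1 u + m2 v := by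
    intro u v
    simp [m1, m2, ← map_add]
  have hU : ∀ u v : X, ‖u‖ < 1 + ε' → ‖v‖ < ε → m1 u + m2 x + m2 v < c := by
    intro u v hu hv
    have := hF1 (u, x + v) ⟨by simpa using hu, by simpa using hv⟩
    rw [hFm, map_add] at this
    linarith
  have hLL : ∀ k : X, (∀ i < N, coordF φ i k = 0) → ∀ t : ℝ,
      c ≤ m1 x + m2 x + t * (m1 k + m2 k) := by
    intro k hk t
    have := hF2 (x + t • k, x + t • k) ⟨rfl, fun i hi => by simp [hk i hi, hx i hi]⟩
    rw [hFm] at this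
    simp only [map_add, map_smul, smul_eq_mul] at this
    linarith
  have hker : ∀ k : X, (∀ i < N, coordF φ i k = 0) → m1 k + m2 k = 0 := by
    intro k hk
    by_contra hne
    have := hLL k hk ((c - (m1 x + m2 x) - 1) / (m1 k + m2 k))
    rw [div_mul_cancel₀ _ hne] at this
    linarith
  have hc : c ≤ m1 x + m2 x := by simpa using hLL 0 (by simp) 0
  have hb : (1 + ε') * ‖m1‖ + m2 x + ε * ‖m2‖ ≤ c := by
    have h1 : ∀ v : X, ‖v‖ < ε → (1 + ε') * ‖m1‖ ≤ c - m2 x - m2 v := fun v hv =>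
      bound_of_ball m1 (by linarith) fun u hu => by linarith [hU u v hu hv]
    have h2 : ε * ‖m2‖ ≤ c - m2 x - (1 + ε') * ‖m1‖ :=
      bound_of_ball m2 hε fun v hv => by linarith [h1 v hv]
    linarith
  obtain ⟨b1, hb1⟩ := φ.surjective m1
  obtain ⟨b2, hb2⟩ := φ.surjective m2
  have ht : ellTail N (b1 + b2) = 0 := tail_zero_of_ker φ N _ fun k hk => by
    rw [map_add, add_apply, hb1, hb2]; exact hker k hk
  rw [ellTail_add] at ht
  have ht2 : ‖ellTail N b2‖ = ‖ellTail N b1‖ := by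
    rw [eq_neg_of_add_eq_zero_right ht, norm_neg]
  have hn1 : ‖m1‖ = ∑ i ∈ Finset.range N, |b1 i| + ‖ellTail N b1‖ := by
    rw [← hb1, φ.norm_map, ← norm_split]
  have hn2 : ‖m2‖ = ∑ i ∈ Finset.range N, |b2 i| + ‖ellTail N b1‖ := by
    rw [← hb2, φ.norm_map, ← ht2, ← norm_split]
  have hm1x : m1 x ≤ ∑ i ∈ Finset.range N, |b1 i| + ‖ellTail N b1‖ * (1 + ε) := by
    rw [← hb1, phi_split φ N]
    refine add_le_add (Finset.sum_le_sum fun i hi => ?_) ?_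
    · rw [hx i (Finset.mem_range.1 hi)]
      refine (le_abs_self _).trans ?_
      rw [abs_mul]
      exact mul_le_of_le_one_right (abs_nonneg _) (hs i)
    · exact ((le_abs_self _).trans (phi_le φ _ _)).trans
        (mul_le_mul_of_nonneg_left hxn (norm_nonneg _))
  have hs1 : 0 ≤ ∑ i ∈ Finset.range N, |b1 i| := Finset.sum_nonneg fun _ _ => abs_nonneg _
  have hs2 : 0 ≤ ∑ i ∈ Finset.range N, |b2 i| := Finset.sum_nonneg fun _ _ => abs_nonneg _
  have hr := norm_nonneg (ellTail N b1)
  have hz : ε' * ‖m1‖ + ε * (∑ i ∈ Finset.range N, |b2 i|) ≤ 0 := by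
    rw [hn2] at hb
    nlinarith
  have hz1 : ‖m1‖ = 0 := by
    have := mul_nonneg hε.le hs2
    have h3 : 0 ≤ ‖m1‖ := norm_nonneg _
    nlinarith
  have hz2 : ‖m2‖ = 0 := by
    rw [hz1] at hz
    rw [hn2]
    nlinarith
  have e1 := norm_eq_zero.1 hz1
  have e2 := norm_eq_zero.1 hz2
  have := hU 0 0 (by simp; linarith) (by simpa using hε)
  rw [e1, e2] at this hc
  simp at this hc
  linarith

theorem interp_exact [CompleteSpace X] (N : ℕ) (s : ℕ → ℝ) (hs : ∀ i, |s i| ≤ 1) :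
    ∃ x : X, ‖x‖ ≤ 1 ∧ ∀ i < N, coordF φ i x = s i := by
  obtain ⟨x0, hx0⟩ := exists_interp φ N s
  obtain ⟨x1, hx1, hx1n, -⟩ := interp_step φ N s hs x0 hx0 (ε := ‖x0‖ + 1) (ε' := 1)
    (by positivity) one_pos (by linarith)
  have step : ∀ (n : ℕ) (x : X), ∃ y : X,
      ((∀ i < N, coordF φ i x = s i) ∧ ‖x‖ ≤ 1 + (1 / 2 : ℝ) ^ n) →
      ((∀ i < N, coordF φ i y = s i) ∧ ‖y‖ ≤ 1 + (1 / 2 : ℝ) ^ (n + 1)) ∧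
        ‖y - x‖ ≤ (1 / 2 : ℝ) ^ n := by
    intro n x
    by_cases h : (∀ i < N, coordF φ i x = s i) ∧ ‖x‖ ≤ 1 + (1 / 2 : ℝ) ^ n
    · obtain ⟨y, h1, h2, h3⟩ := interp_step φ N s hs x h.1 (ε := (1 / 2 : ℝ) ^ n)
        (ε' := (1 / 2 : ℝ) ^ (n + 1)) (by positivity) (by positivity) h.2
      exact ⟨y, fun _ => ⟨⟨h1, h2⟩, h3⟩⟩
    · exact ⟨x, fun h' => absurd h' h⟩
  choose g hg using step
  let x : ℕ → X := fun n => Nat.rec x1 g n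
  have hP : ∀ n, (∀ i < N, coordF φ i (x n) = s i) ∧ ‖x n‖ ≤ 1 + (1 / 2 : ℝ) ^ n := by
    intro n
    induction n with
    | zero => exact ⟨hx1, by rw [pow_zero]; exact hx1n⟩
    | succ n ih => exact (hg n (x n) ih).1
  have hdist : ∀ n, dist (x n) (x (n + 1)) ≤ 1 * (1 / 2 : ℝ) ^ n := by
    intro n
    rw [dist_comm, dist_eq_norm, one_mul]
    exact (hg n (x n) (hP n)).2
  obtain ⟨z, hz⟩ := cauchySeq_tendsto_of_complete
    (cauchySeq_of_le_geometric (1 / 2 : ℝ) 1 (by norm_num) hdist)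
  refine ⟨z, ?_, fun i hi => ?_⟩
  · have h1 : Filter.Tendsto (fun n : ℕ => 1 + (1 / 2 : ℝ) ^ n) Filter.atTop (nhds (1 + 0)) :=
      (tendsto_pow_atTop_nhds_zero_of_lt_one (by norm_num) (by norm_num)).const_add 1
    rw [add_zero] at h1
    exact le_of_tendsto_of_tendsto' hz.norm h1 fun n => (hP n).2
  · have h1 := ((coordF φ i).continuous.tendsto z).comp hz
    refine tendsto_nhds_unique h1 ?_
    refine tendsto_const_nhds.congr fun n => ?_
    exact ((hP n).1 i hi).symm

theorem phi_apply_finite (N : ℕ) (a : EllOne) (ha : ellTail N a = 0) (M : ℕ) (hM : N ≤ M)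
    (x : X) : φ a x = ∑ i ∈ Finset.range M, a i * coordF φ i x := by
  have : ellTail M a = 0 := by
    ext j
    have h := congrArg (fun b : EllOne => b j) ha
    simp only [ellTail_apply] at h ⊢
    split_ifs with h1
    · rfl
    · rwa [if_neg (by omega)] at h
  rw [phi_split φ M, this]; simp

theorem exists_pos [CompleteSpace X] (N : ℕ) (a : EllOne) (ha : ellTail N a = 0) (b : EllOne)
    (hab : SBJOrth (φ a) (φ b)) : ∃ x : X, ‖x‖ ≤ 1 ∧ φ a x = ‖φ a‖ ∧ 0 < φ b x := by
  have hτ : ∃ τ : ℝ, 0 < τ ∧ ∀ i ∈ Finset.range N, a i ≠ 0 → τ * |b i| ≤ |a i| := by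
    have h1 : ∀ᶠ τ : ℝ in nhdsWithin 0 (Set.Ioi 0),
        ∀ i ∈ Finset.range N, a i ≠ 0 → τ * |b i| ≤ |a i| := by
      rw [Filter.eventually_all_finset]
      intro i _
      by_cases h : a i = 0
      · simp [h]
      · have h2 : Filter.Tendsto (fun τ : ℝ => τ * |b i|) (nhds 0) (nhds (0 * |b i|)) :=
          Filter.tendsto_id.mul_const _
        rw [zero_mul] at h2
        have h3 := (h2.eventually_lt_const (abs_pos.2 h)).filter_mono
          (nhdsWithin_le_nhds (s := Set.Ioi (0 : ℝ)))
        filter_upwards [h3] with τ hτ _ using hτ.le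
    obtain ⟨τ, h2, h3⟩ := (h1.and self_mem_nhdsWithin).exists
    exact ⟨τ, h3, h2⟩
  obtain ⟨τ, hτ, hτ'⟩ := hτ
  have hlt := hab τ hτ.ne'
  rw [← map_smul, ← map_add, φ.norm_map, φ.norm_map] at hlt
  set d : EllOne := a + τ • b with hd
  have hdi : ∀ i, d i = a i + τ * b i := fun i => by
    rw [hd]; rfl
  let σ : ℕ → ℝ := fun i => if a i = 0 then (if 0 ≤ b i then 1 else -1)
    else (if 0 ≤ a i then 1 else -1)
  have hσ1 : ∀ i, |σ i| ≤ 1 := by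
    intro i; simp only [σ]; split_ifs <;> simp
  have hσa : ∀ i, a i * σ i = |a i| := by
    intro i; simp only [σ]
    split_ifs with h1 h2 h3
    · simp [h1]
    · simp [h1]
    · rw [abs_of_nonneg h3, mul_one]
    · rw [abs_of_neg (not_le.1 h3)]; ring
  have haz : ∀ i, ¬ i < N → a i = 0 := by
    intro i hi
    have h := congrArg (fun b : EllOne => b i) ha
    simp only [ellTail_apply, if_neg hi] at h
    exact h
  have hσd : ∀ i, d i * σ i = |d i| := by
    intro i
    rw [hdi]
    by_cases h1 : a i = 0
    · simp only [σ, h1, if_true, zero_add, abs_mul, abs_of_pos hτ]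
      split_ifs with h3
      · rw [abs_of_nonneg h3, mul_one]
      · rw [abs_of_neg (not_le.1 h3)]; ring
    · have hi : i < N := by by_contra hi; exact h1 (haz i hi)
      have h2 := hτ' i (Finset.mem_range.2 hi) h1
      have h4 := mul_le_mul_of_nonneg_left (le_abs_self (b i)) hτ.le
      have h5 := mul_le_mul_of_nonneg_left (neg_abs_le (b i)) hτ.le
      simp only [σ, h1, if_false]
      split_ifs with h3
      · rw [abs_of_nonneg h3] at h2
        rw [abs_of_nonneg (by linarith), mul_one]
      · rw [abs_of_neg (not_le.1 h3)] at h2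
        rw [abs_of_nonpos (by linarith)]; ring
  obtain ⟨M, hM, hMs⟩ := ellTail_small d (ε := (‖d‖ - ‖a‖) / 2) (by linarith) N
  obtain ⟨x, hx, hxi⟩ := interp_exact φ M σ hσ1
  have hax : φ a x = ‖a‖ := by
    rw [phi_apply_finite φ N a ha N le_rfl, norm_split N, ha, norm_zero, add_zero]
    refine Finset.sum_congr rfl fun i hi => ?_
    rw [hxi i (lt_of_lt_of_le (Finset.mem_range.1 hi) hM), hσa]
  have hdx : ‖a‖ < φ d x := by
    rw [phi_split φ M]
    have h1 : ∑ i ∈ Finset.range M, d i * coordF φ i x = ∑ i ∈ Finset.range M, |d i| :=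
      Finset.sum_congr rfl fun i hi => by rw [hxi i (Finset.mem_range.1 hi), hσd]
    have h2 := (abs_le.1 (phi_le φ (ellTail M d) x)).1
    have h3 := mul_le_of_le_one_right (norm_nonneg (ellTail M d)) hx
    have h4 := norm_split M d
    rw [h1]
    linarith
  refine ⟨x, hx, by rw [φ.norm_map, hax], ?_⟩
  have : φ d x = φ a x + τ * φ b x := by simp [hd]
  rw [this, hax] at hdx
  by_contra h
  nlinarith

theorem hasBSa_finite [CompleteSpace X] (N : ℕ) (a : EllOne) (ha : ellTail N a = 0) :
    HasBSa (φ a) := by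
  obtain ⟨u, hu⟩ : ∃ u : X, ‖u‖ = 1 := by
    obtain ⟨y, hy⟩ := exists_interp φ 1 (fun _ => (1 : ℝ))
    have hy0 : y ≠ 0 := by
      rintro rfl
      simpa using hy 0 one_pos
    exact ⟨‖y‖⁻¹ • y, by rw [norm_smul, norm_inv, norm_norm, inv_mul_cancel₀ (norm_ne_zero_iff.2 hy0)]⟩
  by_cases h0 : φ a = 0
  · rw [h0]
    exact ⟨⟨u, hu, by simp⟩, fun S _ => ⟨u, hu, by simp, fun t => by simp; positivity⟩⟩
  have hpos : 0 < ‖φ a‖ := norm_pos_iff.2 h0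
  have hone : ∀ x : X, ‖x‖ ≤ 1 → φ a x = ‖φ a‖ → ‖x‖ = 1 := by
    intro x hx hax
    refine le_antisymm hx ?_
    have := (φ a).le_opNorm x
    rw [hax, norm_norm] at this
    by_contra hc
    nlinarith
  refine ⟨?_, fun S hS => ?_⟩
  · let σ : ℕ → ℝ := fun i => if 0 ≤ a i then 1 else -1
    obtain ⟨x, hx, hxi⟩ := interp_exact φ N σ (by
      intro i; simp only [σ]; split_ifs <;> simp)
    have hax : φ a x = ‖φ a‖ := by
      rw [φ.norm_map, phi_apply_finite φ N a ha N le_rfl, norm_split N, ha, norm_zero, add_zero]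
      refine Finset.sum_congr rfl fun i hi => ?_
      rw [hxi i (Finset.mem_range.1 hi)]
      simp only [σ]
      split_ifs with h3
      · rw [abs_of_nonneg h3, mul_one]
      · rw [abs_of_neg (not_le.1 h3)]; ring
    exact ⟨x, hone x hx hax, by rw [hax, norm_norm]⟩
  · obtain ⟨b, rfl⟩ := φ.surjective S
    obtain ⟨p, hp, hpa, hpb⟩ := exists_pos φ N a ha b hS
    obtain ⟨q, hq, hqa, hqb⟩ := exists_pos φ N a ha (-b) (by
      intro t ht
      have := hS (-t) (neg_ne_zero.2 ht)
      simpa using this)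
    simp only [map_neg, neg_apply] at hqb
    have hden : 0 < φ b p - φ b q := by linarith
    set α : ℝ := -(φ b q) / (φ b p - φ b q) with hα
    set β : ℝ := φ b p / (φ b p - φ b q) with hβ
    have hα0 : 0 ≤ α := div_nonneg (by linarith) hden.le
    have hβ0 : 0 ≤ β := div_nonneg hpb.le hden.le
    have hαβ : α + β = 1 := by
      rw [hα, hβ, ← add_div, div_eq_one_iff_eq hden.ne']; ring
    have hz0 : φ b (α • p + β • q) = 0 := by
      simp only [map_add, map_smul, smul_eq_mul, hα, hβ]
      field_simp
      ring
    have hza : φ a (α • p + β • q) = ‖φ a‖ := by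
      simp only [map_add, map_smul, smul_eq_mul, hpa, hqa]
      rw [← add_mul, hαβ, one_mul]
    have hzn : ‖α • p + β • q‖ ≤ 1 := by
      refine (norm_add_le _ _).trans ?_
      rw [norm_smul, norm_smul, Real.norm_of_nonneg hα0, Real.norm_of_nonneg hβ0]
      nlinarith
    refine ⟨_, hone _ hzn hza, by rw [hza, norm_norm], fun t => ?_⟩
    rw [hz0]; simp

end Predual

/-- For an `ℓ₁`-predual `X`, the set of functionals with the adjusted Bhatia-Semrl property is
weak-* dense in the dual of `X`. -/
theorem weakStarDense_hasBSa_l1_predual (X : Type*) [NormedAddCommGroup X]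
    [NormedSpace ℝ X] [CompleteSpace X]
    (φ : lp (fun _ : ℕ => ℝ) 1 ≃ₗᵢ[ℝ] (X →L[ℝ] ℝ)) :
    Dense (⇑(StrongDual.toWeakDual (𝕜 := ℝ) (E := X)) ''
      {f : X →L[ℝ] ℝ | HasBSa f}) := by
  have hd : Dense {f : X →L[ℝ] ℝ | HasBSa f} := by
    intro f
    obtain ⟨a, rfl⟩ := φ.surjective f
    refine mem_closure_of_tendsto ((φ.continuous.tendsto a).comp (ellTail_tendsto a))
      (Filter.Eventually.of_forall fun N => ?_)
    refine hasBSa_finite φ N _ ?_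
    ext j
    rw [ellTail_apply]
    split_ifs with hj
    · rfl
    · simp only [lp.coeFn_sum, Finset.sum_apply, lp.single_apply, Finset.sum_pi_single,
        Finset.mem_range, hj, if_false]
      rfl
  exact (StrongDual.toWeakDual (𝕜 := ℝ) (E := X)).surjective.denseRange.dense_image
    NormedSpace.Dual.toWeakDual_continuous hd
end

section
/- The set BSa(C([0,1],ℝ),ℝ) of bounded linear functionals on C([0,1],ℝ) having the adjusted Bhatia-Šemrl property is dense in the dual space C([0,1],ℝ)* with respect to the weak-* topology. -/
open scoped BigOperators

section Helpers

variable {K : Type*} [TopologicalSpace K] [CompactSpace K] [T2Space K]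

/-- The evaluation functional. -/
noncomputable def evF (t : K) : C(K, ℝ) →L[ℝ] ℝ := ContinuousMap.evalCLM ℝ t

/-- The functional attached to a finitely supported measure. -/
noncomputable def finF (c : K →₀ ℝ) : C(K, ℝ) →L[ℝ] ℝ := ∑ t ∈ c.support, c t • evF t

theorem finF_apply (c : K →₀ ℝ) (x : C(K, ℝ)) : finF c x = ∑ t ∈ c.support, c t * x t := by
  simp [finF, evF]

/-- The sign of a coefficient. -/
noncomputable def sg (a : ℝ) : ℝ := if 0 < a then 1 else -1

theorem sg_sq (a : ℝ) : sg a * sg a = 1 := by unfold sg; split_ifs <;> norm_num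

theorem abs_sg (a : ℝ) : |sg a| = 1 := by unfold sg; split_ifs <;> norm_num

theorem mul_sg (a : ℝ) : a * sg a = |a| := by
  unfold sg; split_ifs with h
  · rw [abs_of_pos h]; ring
  · rw [abs_of_nonpos (not_lt.1 h)]; ring

theorem abs_sg_mul (a : ℝ) : |a| * sg a = a := by
  rw [← mul_sg, mul_assoc, sg_sq, mul_one]

theorem clamp_sub_le (z y : ℝ) (hy : |y| ≤ 1) : |max (-1) (min 1 z) - y| ≤ |z - y| := by
  grind

theorem sg_mul_le (a y : ℝ) (hy : |y| ≤ 1) : 0 ≤ 1 - sg a * y := by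
  unfold sg; have := abs_le.1 hy; split_ifs <;> linarith

/-- Correct a function in the unit ball to take prescribed signs. -/
theorem adjust (c : K →₀ ℝ) (y : C(K, ℝ)) (hy : ‖y‖ ≤ 1) :
    ∃ x : C(K, ℝ), ‖x‖ ≤ 1 ∧ (∀ t ∈ c.support, x t = sg (c t)) ∧
      ‖x - y‖ ≤ ∑ t ∈ c.support, (1 - sg (c t) * y t) := by
  classical
  have hy' : ∀ u, |y u| ≤ 1 := fun u => (y.norm_coe_le_norm u).trans hy
  have hb : ∀ t : K, ∃ h : C(K, ℝ), h t = 1 ∧ (∀ s ∈ c.support, s ≠ t → h s = 0) ∧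
      ∀ u, |h u| ≤ 1 := by
    intro t
    have hc : IsClosed ((c.support.erase t : Finset K) : Set K) := (Finset.finite_toSet _).isClosed
    obtain ⟨h, h0, h1, h2⟩ := exists_continuous_zero_one_of_isClosed hc
      (isClosed_singleton (x := t)) (by simp)
    refine ⟨h, h1 rfl, fun s hs hst => h0 (by simp_all), fun u => ?_⟩
    rw [abs_of_nonneg (h2 u).1]; exact (h2 u).2
  choose h h1 h0 hle using hb
  let z : C(K, ℝ) := y + ∑ t ∈ c.support, ((1 - sg (c t) * y t) * sg (c t)) • h t
  have hz : ∀ u, z u = y u + ∑ t ∈ c.support, ((1 - sg (c t) * y t) * sg (c t)) * h t u := by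
    intro u; simp [z, ContinuousMap.sum_apply]
  let x : C(K, ℝ) := ⟨fun u => max (-1) (min 1 (z u)), by fun_prop⟩
  have hx : ∀ u, x u = max (-1) (min 1 (z u)) := fun _ => rfl
  refine ⟨x, ?_, ?_, ?_⟩
  · rw [ContinuousMap.norm_le _ zero_le_one]
    intro u
    rw [hx, Real.norm_eq_abs, abs_le]
    exact ⟨le_max_left _ _, max_le (by norm_num) (min_le_left _ _)⟩
  · intro t ht
    have : z t = sg (c t) := by
      rw [hz, Finset.sum_eq_single_of_mem t ht, h1]
      · linear_combination (-y t) * sg_sq (c t)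
      · intro s hs hst
        rw [h0 s t ht (Ne.symm hst), mul_zero]
    rw [hx, this]
    unfold sg; split_ifs <;> norm_num
  · rw [ContinuousMap.norm_le _ (Finset.sum_nonneg fun t _ => sg_mul_le _ _ (hy' t))]
    intro u
    rw [ContinuousMap.sub_apply, hx, Real.norm_eq_abs]
    refine (clamp_sub_le _ _ (hy' u)).trans ?_
    rw [hz, add_sub_cancel_left]
    refine (Finset.abs_sum_le_sum_abs _ _).trans (Finset.sum_le_sum fun t _ => ?_)
    rw [abs_mul, abs_mul, abs_sg, mul_one, abs_of_nonneg (sg_mul_le _ _ (hy' t))]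
    exact mul_le_of_le_one_right (sg_mul_le _ _ (hy' t)) (hle t u)

theorem finF_of_sign (c : K →₀ ℝ) (x : C(K, ℝ)) (hx : ∀ t ∈ c.support, x t = sg (c t)) :
    finF c x = ∑ t ∈ c.support, |c t| := by
  rw [finF_apply]
  exact Finset.sum_congr rfl fun t ht => by rw [hx t ht, mul_sg]

theorem finF_eq (c : K →₀ ℝ) (y : C(K, ℝ)) :
    finF c y = ∑ t ∈ c.support, |c t| - ∑ t ∈ c.support, |c t| * (1 - sg (c t) * y t) := by
  rw [finF_apply, ← Finset.sum_sub_distrib]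
  refine Finset.sum_congr rfl fun t _ => ?_
  linear_combination (-y t) * abs_sg_mul (c t)

theorem opNorm_le_of_unit (T : C(K, ℝ) →L[ℝ] ℝ) (M : ℝ) (hM : 0 ≤ M)
    (h : ∀ y : C(K, ℝ), ‖y‖ ≤ 1 → T y ≤ M) : ‖T‖ ≤ M := by
  refine T.opNorm_le_of_unit_norm hM fun y hy => ?_
  rw [Real.norm_eq_abs, abs_le]
  have h1 := h y hy.le
  have h2 := h (-y) (by rw [norm_neg]; exact hy.le)
  rw [map_neg] at h2
  constructor <;> linarith

theorem finF_norm (c : K →₀ ℝ) : ‖finF c‖ = ∑ t ∈ c.support, |c t| := by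
  apply le_antisymm
  · refine opNorm_le_of_unit _ _ (Finset.sum_nonneg fun _ _ => abs_nonneg _) fun y hy => ?_
    rw [finF_eq]
    have : 0 ≤ ∑ t ∈ c.support, |c t| * (1 - sg (c t) * y t) :=
      Finset.sum_nonneg fun t _ => mul_nonneg (abs_nonneg _)
        (sg_mul_le _ _ ((y.norm_coe_le_norm t).trans hy))
    linarith
  · obtain ⟨x, hx1, hx2, -⟩ := adjust c 0 (by simp)
    rw [← finF_of_sign c x hx2]
    exact (le_abs_self _).trans ((finF c).unit_le_opNorm x hx1)

theorem exists_neg (c : K →₀ ℝ) (g : C(K, ℝ) →L[ℝ] ℝ) (hg : SBJOrth (finF c) g) :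
    ∃ x : C(K, ℝ), ‖x‖ ≤ 1 ∧ (∀ t ∈ c.support, x t = sg (c t)) ∧ g x < 0 := by
  by_contra! hcon
  obtain ⟨m, hm, hmc⟩ : ∃ m : ℝ, 0 < m ∧ ∀ t ∈ c.support, m ≤ |c t| := by
    rcases c.support.eq_empty_or_nonempty with h | h
    · exact ⟨1, one_pos, by simp [h]⟩
    · obtain ⟨s, hs, hmin⟩ := c.support.exists_min_image (fun t => |c t|) h
      exact ⟨|c s|, abs_pos.2 (Finsupp.mem_support_iff.1 hs), hmin⟩
  let l : ℝ := m / (‖g‖ + 1)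
  have hg0 := norm_nonneg g
  have hl : 0 < l := by positivity
  have hlm : l * ‖g‖ ≤ m := by
    have : l * (‖g‖ + 1) = m := by simp only [l]; field_simp
    linarith
  have := hg (-l) (by linarith)
  refine absurd this (not_lt.2 ?_)
  rw [finF_norm]
  refine opNorm_le_of_unit _ _ (Finset.sum_nonneg fun _ _ => abs_nonneg _) fun y hy => ?_
  obtain ⟨x, hx1, hx2, hx3⟩ := adjust c y hy
  have hgx := hcon x hx1 hx2
  have h1 : g x - g y ≤ ‖g‖ * ∑ t ∈ c.support, (1 - sg (c t) * y t) := by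
    rw [← map_sub]
    exact (le_abs_self _).trans ((g.le_opNorm _).trans (mul_le_mul_of_nonneg_left hx3 hg0))
  have h2 : (l * ‖g‖) * ∑ t ∈ c.support, (1 - sg (c t) * y t) ≤
      ∑ t ∈ c.support, |c t| * (1 - sg (c t) * y t) := by
    rw [Finset.mul_sum]
    exact Finset.sum_le_sum fun t ht => mul_le_mul_of_nonneg_right (hlm.trans (hmc t ht))
      (sg_mul_le _ _ ((y.norm_coe_le_norm t).trans hy))
  have h3 : (finF c + (-l) • g) y = finF c y - l * g y := by
    simp; ring
  rw [h3, finF_eq]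
  have h4 := mul_le_mul_of_nonneg_left h1 hl.le
  nlinarith [mul_nonneg hl.le hgx]

theorem hasBSa_finF [Nonempty K] (c : K →₀ ℝ) : HasBSa (finF c) := by
  by_cases hc : c = 0
  · have h0 : finF c = 0 := by simp [hc, finF]
    rw [h0]
    refine ⟨⟨1, by simp, by simp⟩, fun S _ => ⟨1, by simp, by simp, fun t => by simp; positivity⟩⟩
  obtain ⟨s, hs⟩ := Finsupp.support_nonempty_iff.2 hc
  have hnorm : ∀ x : C(K, ℝ), ‖x‖ ≤ 1 → (∀ t ∈ c.support, x t = sg (c t)) →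
      ‖x‖ = 1 ∧ ‖finF c x‖ = ‖finF c‖ := by
    intro x hx1 hx2
    refine ⟨le_antisymm hx1 ?_, ?_⟩
    · rw [← abs_sg (c s), ← hx2 s hs]; exact x.norm_coe_le_norm s
    · rw [finF_of_sign c x hx2, finF_norm, Real.norm_eq_abs, abs_of_nonneg]
      exact Finset.sum_nonneg fun _ _ => abs_nonneg _
  refine ⟨?_, fun g hg => ?_⟩
  · obtain ⟨x, hx1, hx2, -⟩ := adjust c 0 (by simp)
    exact ⟨x, hnorm x hx1 hx2⟩
  obtain ⟨x, hx1, hx2, hx3⟩ := exists_neg c g hg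
  obtain ⟨y, hy1, hy2, hy3⟩ := exists_neg c (-g) (fun t ht => by
    have := hg (-t) (neg_ne_zero.2 ht)
    simpa using this)
  replace hy3 : 0 < g y := by simpa using hy3
  have hd : 0 < g y - g x := by linarith
  let a : ℝ := g y / (g y - g x)
  let b : ℝ := -g x / (g y - g x)
  have ha : 0 ≤ a := by positivity
  have hb : 0 ≤ b := div_nonneg (by linarith) hd.le
  have hab : a + b = 1 := by simp only [a, b]; field_simp; ring
  have h0 : g (a • x + b • y) = 0 := by
    simp only [map_add, map_smul, smul_eq_mul, a, b]; field_simp; ring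
  obtain ⟨h1, h2⟩ := hnorm (a • x + b • y)
    (by
      refine (norm_add_le _ _).trans ?_
      rw [norm_smul, norm_smul, Real.norm_of_nonneg ha, Real.norm_of_nonneg hb]
      nlinarith)
    (fun t ht => by
      simp only [ContinuousMap.add_apply, ContinuousMap.smul_apply, smul_eq_mul, hx2 t ht,
        hy2 t ht]
      rw [← add_mul, hab, one_mul])
  exact ⟨_, h1, h2, fun t => by rw [h0]; simp⟩

/-- Finitely supported functionals interpolate any functional on finitely many vectors. -/
theorem exists_interp_s17 (φ : C(K, ℝ) →L[ℝ] ℝ) (I : Finset C(K, ℝ)) :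
    ∃ c : K →₀ ℝ, ∀ x ∈ I, finF c x = φ x := by
  classical
  let w : K → (I → ℝ) := fun t i => i.1 t
  let v : I → ℝ := fun i => φ i.1
  have hv : v ∈ Submodule.span ℝ (Set.range w) := by
    by_contra hv
    obtain ⟨L, hL, hle⟩ := Submodule.exists_le_ker_of_notMem hv
    have hLs : ∀ u : I → ℝ, L u = ∑ i, u i * L (fun j => if i = j then 1 else 0) := by
      intro u; simpa using L.pi_apply_eq_sum_univ u
    have hz : ∑ i : I, L (fun j => if i = j then 1 else 0) • i.1 = (0 : C(K, ℝ)) := by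
      ext t
      have : L (w t) = 0 := hle (Submodule.subset_span ⟨t, rfl⟩)
      rw [hLs] at this
      simp only [ContinuousMap.sum_apply, ContinuousMap.smul_apply, smul_eq_mul,
        ContinuousMap.zero_apply]
      exact (Finset.sum_congr rfl fun i _ => mul_comm _ _).trans this
    apply hL
    have h2 := congrArg φ hz
    rw [map_sum, map_zero] at h2
    rw [hLs]
    exact (Finset.sum_congr rfl fun i _ => by rw [map_smul, smul_eq_mul, mul_comm]).trans h2
  obtain ⟨c, hc⟩ := Finsupp.mem_span_range_iff_exists_finsupp.1 hv
  refine ⟨c, fun x hx => ?_⟩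
  have := congrFun hc ⟨x, hx⟩
  rw [finF_apply]
  simpa [Finsupp.sum, w, v] using this

end Helpers

/-- The set of functionals on `C([0,1],ℝ)` with the adjusted Bhatia-Semrl property is weak-*
dense in the dual of `C([0,1],ℝ)`. -/
theorem weakStarDense_hasBSa_C01 :
    Dense (⇑(StrongDual.toWeakDual (𝕜 := ℝ) (E := C(Set.Icc (0:ℝ) 1, ℝ))) ''
      {f : C(Set.Icc (0:ℝ) 1, ℝ) →L[ℝ] ℝ | HasBSa f}) := by
  intro φ
  rw [mem_closure_iff_nhds]
  intro U hU
  have hind : Topology.IsInducing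
      (fun (f : WeakDual ℝ C(Set.Icc (0:ℝ) 1, ℝ)) (x : C(Set.Icc (0:ℝ) 1, ℝ)) => f x) := ⟨rfl⟩
  rw [hind.nhds_eq_comap, Filter.mem_comap] at hU
  obtain ⟨V, hV, hVU⟩ := hU
  rw [nhds_pi, Filter.mem_pi] at hV
  obtain ⟨I, hI, s, hs, hsV⟩ := hV
  obtain ⟨c, hc⟩ := exists_interp_s17 (WeakDual.toStrongDual φ) hI.toFinset
  refine ⟨StrongDual.toWeakDual (finF c), hVU (hsV ?_), finF c, hasBSa_finF c, rfl⟩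
  intro x hx
  have h : finF c x = φ x := hc x (hI.mem_toFinset.2 hx)
  change finF c x ∈ s x
  rw [h]
  exact mem_of_mem_nhds (hs x)
end

section
/- The set BS(C([0,1],ℝ),ℝ) of bounded linear functionals on C([0,1],ℝ) having the Bhatia-Šemrl property is not dense in the dual space C([0,1],ℝ)* with respect to the weak-* topology; that is, there exists a nonempty weak-* open subset of C([0,1],ℝ)* that contains no functional with the Bhatia-Šemrl property. -/
open scoped BigOperators

open Filter Topology

abbrev CI := C(Set.Icc (0:ℝ) 1, ℝ)

def GoodPt (f : CI →L[ℝ] ℝ) (ε : ℝ) (p : Set.Icc (0:ℝ) 1) : Prop :=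
  ∃ U ∈ 𝓝 p, ∀ h : CI, ‖h‖ ≤ 1 → (∀ q, q ∉ U → h q = 0) → |f h| ≤ ε

lemma bad_card (f : CI →L[ℝ] ℝ) (ε : ℝ) (S : Finset (Set.Icc (0:ℝ) 1))
    (hS : ∀ p ∈ S, ¬ GoodPt f ε p) : S.card * ε ≤ ‖f‖ := by
  obtain ⟨U, hU, hd⟩ := S.finite_toSet.t2_separation
  have key : ∀ p ∈ S, ∃ h : CI, ‖h‖ ≤ 1 ∧ (∀ q, q ∉ U p → h q = 0) ∧ ε ≤ f h := by
    intro p hp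
    have h1 := hS p hp
    unfold GoodPt at h1
    push Not at h1
    obtain ⟨h, hn, h0, hlt⟩ := h1 (U p) ((hU p).2.mem_nhds (hU p).1)
    rcases le_total 0 (f h) with hf | hf
    · exact ⟨h, hn, h0, by rw [abs_of_nonneg hf] at hlt; exact hlt.le⟩
    · refine ⟨-h, by simpa using hn, fun q hq => by simp [h0 q hq], ?_⟩
      rw [abs_of_nonpos hf] at hlt
      simpa using hlt.le
  choose! h hn h0 hf using key
  have hle : ‖∑ p ∈ S, h p‖ ≤ 1 := by
    rw [ContinuousMap.norm_le _ zero_le_one]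
    intro q
    rw [ContinuousMap.sum_apply]
    by_cases hq : ∃ p ∈ S, q ∈ U p
    · obtain ⟨p, hp, hqp⟩ := hq
      rw [Finset.sum_eq_single_of_mem p hp]
      · exact ((h p).norm_coe_le_norm q).trans (hn p hp)
      · intro b hb hbp
        apply h0 b hb
        intro hqb
        exact Set.disjoint_left.1 (hd hb hp hbp) hqb hqp
    · push Not at hq
      rw [Finset.sum_eq_zero (fun p hp => h0 p hp q (hq p hp))]
      simp
  calc (S.card : ℝ) * ε = ∑ p ∈ S, ε := by simp
    _ ≤ ∑ p ∈ S, f (h p) := Finset.sum_le_sum hf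
    _ = f (∑ p ∈ S, h p) := by simp
    _ ≤ ‖f (∑ p ∈ S, h p)‖ := le_abs_self _
    _ ≤ ‖f‖ * 1 := f.le_opNorm_of_le hle
    _ = ‖f‖ := mul_one _

lemma bad_finite (f : CI →L[ℝ] ℝ) (ε : ℝ) (hε : 0 < ε) : {p | ¬ GoodPt f ε p}.Finite := by
  by_contra hinf
  obtain ⟨n, hn⟩ := exists_nat_gt (‖f‖ / ε)
  obtain ⟨S, hS, hc⟩ := Set.Infinite.exists_subset_card_eq hinf n
  have := bad_card f ε S (fun p hp => hS hp)
  rw [hc] at this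
  rw [div_lt_iff₀ hε] at hn
  linarith

lemma bad_countable (f : CI →L[ℝ] ℝ) : {p | ¬ ∀ ε > 0, GoodPt f ε p}.Countable := by
  have : {p | ¬ ∀ ε > 0, GoodPt f ε p} ⊆ ⋃ k : ℕ, {p | ¬ GoodPt f (1 / ((k:ℝ) + 1)) p} := by
    intro p hp
    simp only [Set.mem_ofPred_eq] at hp
    push Not at hp
    obtain ⟨ε, hε, hb⟩ := hp
    obtain ⟨k, hk⟩ := exists_nat_one_div_lt hε
    refine Set.mem_iUnion.2 ⟨k, fun hg => hb ?_⟩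
    obtain ⟨U, hU, h⟩ := hg
    exact ⟨U, hU, fun x h1 h2 => (h x h1 h2).trans hk.le⟩
  exact (Set.countable_iUnion fun k => (bad_finite f _ (by positivity)).countable).mono this

lemma exists_seq (f : CI →L[ℝ] ℝ) : ∃ p : ℕ → Set.Icc (0:ℝ) 1, Function.Injective p ∧
    (∃ z, Tendsto p atTop (𝓝 z)) ∧ ∀ n, ∀ ε > 0, GoodPt f ε (p n) := by
  have hc := (bad_countable f).image (Subtype.val)
  have hd := hc.dense_compl ℝ
  have hlt : ∀ n : ℕ, 1 / ((n:ℝ) + 2) < 1 / ((n:ℝ) + 1) := fun n =>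
    one_div_lt_one_div_of_lt (by positivity) (by linarith)
  have : ∀ n : ℕ, ∃ r : ℝ, r ∈ Set.Ioo (1 / ((n:ℝ) + 2)) (1 / ((n:ℝ) + 1)) ∧
      r ∉ (Subtype.val '' {p | ¬ ∀ ε > 0, GoodPt f ε p}) := by
    intro n
    obtain ⟨r, h1, h2⟩ := hd.exists_between (hlt n)
    exact ⟨r, h2, h1⟩
  choose r hr hr' using this
  have hpos : ∀ n, 0 < r n := fun n => lt_trans (by positivity) (hr n).1
  have hle : ∀ n, r n ≤ 1 := fun n => (hr n).2.le.trans (by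
    rw [div_le_one (by positivity)]; linarith [n.cast_nonneg (α := ℝ)])
  have hanti : StrictAnti r := strictAnti_nat_of_succ_lt fun n => by
    have h1 := (hr (n+1)).2
    have h2 := (hr n).1
    push_cast at h1
    rw [show (n:ℝ) + 1 + 1 = n + 2 by ring] at h1
    exact h1.trans h2
  refine ⟨fun n => ⟨r n, (hpos n).le, hle n⟩, ?_, ⟨⟨0, by simp⟩, ?_⟩, ?_⟩
  · intro a b hab
    exact hanti.injective (congrArg Subtype.val hab)
  · rw [tendsto_subtype_rng]
    exact squeeze_zero (fun n => (hpos n).le) (fun n => (hr n).2.le)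
      tendsto_one_div_add_atTop_nhds_zero_nat
  · intro n
    by_contra hb
    exact hr' n ⟨_, hb, rfl⟩

lemma interp (f : CI →L[ℝ] ℝ) (s : Set.Icc (0:ℝ) 1 → ℝ) (hs : ∀ p, |s p| ≤ 1)
    (F : Finset (Set.Icc (0:ℝ) 1)) (hF : ∀ p ∈ F, ∀ ε > 0, GoodPt f ε p) (y : CI)
    (hy : ‖y‖ ≤ 1) : ∀ ε > 0, ∃ x : CI, ‖x‖ ≤ 1 ∧ (∀ p ∈ F, x p = s p) ∧ |f x - f y| ≤ ε := by
  classical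
  induction F using Finset.induction_on with
  | empty => intro ε hε; exact ⟨y, hy, by simp, by simpa using hε.le⟩
  | insert p F hp ih =>
    intro ε hε
    obtain ⟨x, hx, hxs, hxf⟩ := ih (fun q hq => hF q (Finset.mem_insert_of_mem hq)) (ε/2)
      (by positivity)
    obtain ⟨U, hU, h⟩ := hF p (Finset.mem_insert_self _ _) (ε/4) (by positivity)
    have hV : U ∩ (F : Set (Set.Icc (0:ℝ) 1))ᶜ ∈ 𝓝 p :=
      inter_mem hU (F.finite_toSet.isClosed.isOpen_compl.mem_nhds (by simpa using hp))
    obtain ⟨V, hVs, hVo, hpV⟩ := mem_nhds_iff.1 hV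
    obtain ⟨φ, h0, h1, h01⟩ := exists_continuous_zero_one_of_isClosed (hVo.isClosed_compl)
      (isClosed_singleton (x := p)) (by simpa using hpV)
    have hx' : ∀ q, |x q| ≤ 1 := fun q => (x.norm_coe_le_norm q).trans hx
    let d : CI := φ * (ContinuousMap.const _ (s p) - x)
    have hdq : ∀ q, d q = φ q * (s p - x q) := fun q => rfl
    have hd0 : ∀ q, q ∉ V → d q = 0 := by
      intro q hq
      rw [hdq, h0 (by simpa using hq)]; simp
    refine ⟨x + d, ?_, ?_, ?_⟩
    · rw [ContinuousMap.norm_le _ zero_le_one]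
      intro q
      rw [ContinuousMap.add_apply, hdq, Real.norm_eq_abs]
      have a1 := abs_le.1 (hx' q)
      have a2 := abs_le.1 (hs p)
      have a3 := h01 q
      rw [abs_le]
      constructor <;> nlinarith [a3.1, a3.2]
    · intro q hq
      rcases Finset.mem_insert.1 hq with rfl | hq
      · rw [ContinuousMap.add_apply, hdq, h1 (by simp)]; simp
      · rw [ContinuousMap.add_apply, hd0 q (fun hqV => (hVs hqV).2 (by simpa using hq)), hxs q hq,
          add_zero]
    · have hh := h ((1/2:ℝ) • d) ?_ ?_
      · rw [map_smul, smul_eq_mul, abs_mul, abs_of_pos (by norm_num : (0:ℝ) < 1/2)] at hh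
        rw [map_add]
        have := abs_add_le (f x - f y) (f d)
        rw [show f x + f d - f y = f x - f y + f d by ring]
        linarith
      · rw [ContinuousMap.norm_le _ zero_le_one]
        intro q
        rw [ContinuousMap.smul_apply, hdq, Real.norm_eq_abs, smul_eq_mul]
        have a1 := abs_le.1 (hx' q)
        have a2 := abs_le.1 (hs p)
        have a3 := h01 q
        rw [abs_le]
        constructor <;> nlinarith [a3.1, a3.2]
      · intro q hq
        rw [ContinuousMap.smul_apply, hd0 q (fun hqV => hq (hVs hqV).1), smul_zero]

lemma exists_nu_gen {X : Type*} [NormedAddCommGroup X] [NormedSpace ℝ X] (e : ℕ → X →L[ℝ] ℝ)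
    (he : ∀ n, ‖e n‖ ≤ 1) : ∃ ν : X →L[ℝ] ℝ, ∀ x : X,
    HasSum (fun n => (1/2:ℝ)^n * ((-1)^n * e n x)) (ν x) := by
  have hs : Summable (fun n => (-1/2:ℝ)^n • e n) := by
    refine Summable.of_norm_bounded (g := fun n => (1/2:ℝ)^n)
      (summable_geometric_of_lt_one (by norm_num) (by norm_num)) fun n => ?_
    rw [norm_smul, norm_pow]
    have h2 : ‖(-1/2:ℝ)‖ = 1/2 := by norm_num
    rw [h2]
    exact mul_le_of_le_one_right (by positivity) (he n)
  refine ⟨∑' n, (-1/2:ℝ)^n • e n, fun x => ?_⟩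
  have := hs.hasSum.mapL (ContinuousLinearMap.apply ℝ ℝ x)
  simp only [ContinuousLinearMap.apply_apply, ContinuousLinearMap.smul_apply,
      smul_eq_mul] at this
  have hfun : (fun n => (1/2:ℝ)^n * ((-1)^n * e n x)) = fun n => (-1/2:ℝ)^n * e n x := by
    funext n
    rw [← mul_assoc, ← mul_pow]; norm_num
  rw [hfun]
  exact this

lemma gen_norm_pos {X : Type*} [NormedAddCommGroup X] [NormedSpace ℝ X] (f : X →L[ℝ] ℝ)
    (hf : f ≠ 0) : 0 < ‖f‖ := norm_pos_iff.2 hf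

lemma exists_nu (p : ℕ → Set.Icc (0:ℝ) 1) : ∃ ν : CI →L[ℝ] ℝ, ∀ x : CI,
    HasSum (fun n => (1/2:ℝ)^n * ((-1)^n * x (p n))) (ν x) := by
  exact exists_nu_gen (fun n => (ContinuousMap.evalCLM ℝ (p n) : CI →L[ℝ] ℝ)) fun n =>
      ContinuousLinearMap.opNorm_le_bound _ zero_le_one fun x => by
        simpa using x.norm_coe_le_norm (p n)

lemma hasSum_two : HasSum (fun n : ℕ => (1/2:ℝ)^n) 2 := hasSum_geometric_two

lemma norm_lower (f ν : CI →L[ℝ] ℝ) (p : ℕ → Set.Icc (0:ℝ) 1) (hinj : Function.Injective p)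
    (hg : ∀ n, ∀ ε > 0, GoodPt f ε (p n))
    (hν : ∀ x : CI, HasSum (fun n => (1/2:ℝ)^n * ((-1)^n * x (p n))) (ν x)) (a b : ℝ) :
    |a| * ‖f‖ + |b| * 2 ≤ ‖a • f + b • ν‖ := by
  classical
  have sgn : ∀ c : ℝ, ∃ σ : ℝ, |σ| = 1 ∧ c * σ = |c| := fun c => by
    rcases le_total 0 c with h | h
    · exact ⟨1, by simp, by simp [abs_of_nonneg h]⟩
    · exact ⟨-1, by simp, by simp [abs_of_nonpos h]⟩
  obtain ⟨σ, hσ, hσa⟩ := sgn a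
  obtain ⟨τ, hτ, hτb⟩ := sgn b
  have main : ∀ ε > 0, |a| * (‖f‖ - ε) + |b| * (2 - ε) ≤ ‖a • f + b • ν‖ := by
    intro ε hε
    -- near-norming vector
    have hy : ∃ y : CI, ‖y‖ ≤ 1 ∧ ‖f‖ - ε/2 ≤ f y := by
      by_contra hcon
      push Not at hcon
      have h0 : 0 < ‖f‖ - ε/2 := by simpa using hcon 0 (by simp)
      have := f.opNorm_le_of_unit_norm (C := ‖f‖ - ε/2) h0.le (fun x hx => by
        rw [Real.norm_eq_abs, abs_le]
        have h1 := hcon x hx.le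
        have h2 := hcon (-x) (by rw [norm_neg, hx])
        rw [map_neg] at h2
        constructor <;> linarith)
      linarith
    obtain ⟨y, hy1, hyf⟩ := hy
    obtain ⟨N, hN⟩ := exists_pow_lt_of_lt_one (show (0:ℝ) < ε/4 by positivity)
      (show (1/2:ℝ) < 1 by norm_num)
    obtain ⟨s, hs, hsp⟩ : ∃ s : Set.Icc (0:ℝ) 1 → ℝ, (∀ q, |s q| ≤ 1) ∧
        ∀ n, s (p n) = τ * (-1)^n := by
      refine ⟨Function.extend p (fun n => τ * (-1)^n) 0, fun q => ?_, fun n => ?_⟩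
      · by_cases hq : ∃ n, p n = q
        · obtain ⟨n, rfl⟩ := hq
          rw [hinj.extend_apply, abs_mul, hτ, abs_pow]; simp
        · rw [Function.extend_apply' _ _ _ hq]; simp
      · rw [hinj.extend_apply]
    obtain ⟨x, hx, hxs, hxf⟩ := interp f s hs ((Finset.range N).image p) (by
      intro q hq
      obtain ⟨n, -, rfl⟩ := Finset.mem_image.1 hq
      exact hg n) (σ • y) (by rw [norm_smul, Real.norm_eq_abs, hσ, one_mul]; exact hy1)
      (ε/2) (by positivity)
    have hx' : ∀ q, |x q| ≤ 1 := fun q => (x.norm_coe_le_norm q).trans hx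
    -- ν x close to 2τ
    have hνx : |ν x - τ * 2| ≤ ε := by
      have hsum := (hν x).sub (hasSum_two.mul_left τ)
      have h0 : ∀ n < N, (1/2:ℝ)^n * ((-1)^n * x (p n)) - τ * (1/2)^n = 0 := by
        intro n hn
        rw [hxs _ (Finset.mem_image_of_mem _ (Finset.mem_range.2 hn)), hsp]
        have : ((-1:ℝ)^n) * (-1)^n = 1 := by rw [← mul_pow]; simp
        linear_combination τ * (1/2)^n * this
      have h1 := (hasSum_nat_add_iff' N).2 hsum
      rw [Finset.sum_eq_zero (fun n hn => h0 n (Finset.mem_range.1 hn)), sub_zero] at h1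
      have h2 : HasSum (fun n : ℕ => (2 * (1/2:ℝ)^N) * (1/2:ℝ)^n) ((2 * (1/2:ℝ)^N) * 2) :=
        hasSum_two.mul_left _
      have h3 : ‖ν x - τ * 2‖ ≤ (2 * (1/2:ℝ)^N) * 2 := by
        rw [← h1.tsum_eq]
        refine tsum_of_norm_bounded h2 fun n => ?_
        rw [show (1/2:ℝ)^(n+N) * ((-1)^(n+N) * x (p (n+N))) - τ * (1/2)^(n+N)
          = (1/2:ℝ)^(n+N) * ((-1)^(n+N) * x (p (n+N)) - τ) by ring, norm_mul,
          Real.norm_of_nonneg (by positivity), pow_add]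
        have : ‖(-1:ℝ)^(n+N) * x (p (n+N)) - τ‖ ≤ 2 := by
          refine (norm_sub_le _ _).trans ?_
          rw [norm_mul, norm_pow, Real.norm_eq_abs τ, hτ]
          have := hx' (p (n+N))
          simp only [norm_neg, norm_one, one_pow, one_mul, Real.norm_eq_abs]
          linarith
        nlinarith [show (0:ℝ) < (1/2)^n * (1/2)^N by positivity]
      rw [Real.norm_eq_abs] at h3
      linarith
    rw [map_smul, smul_eq_mul] at hxf
    have e1 : |a| * (‖f‖ - ε) ≤ a * f x := by
      have : -(|a| * (ε/2)) ≤ a * (f x - σ * f y) := by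
        have h1 := neg_abs_le (a * (f x - σ * f y))
        rw [abs_mul] at h1
        nlinarith [mul_le_mul_of_nonneg_left hxf (abs_nonneg a)]
      have h2 : a * (σ * f y) = |a| * f y := by rw [← mul_assoc, hσa]
      nlinarith [mul_le_mul_of_nonneg_left hyf (abs_nonneg a)]
    have e2 : |b| * (2 - ε) ≤ b * ν x := by
      have h1 := neg_abs_le (b * (ν x - τ * 2))
      rw [abs_mul] at h1
      have h2 : b * (τ * 2) = |b| * 2 := by rw [← mul_assoc, hτb]
      nlinarith [mul_le_mul_of_nonneg_left hνx (abs_nonneg b)]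
    calc |a| * (‖f‖ - ε) + |b| * (2 - ε) ≤ a * f x + b * ν x := add_le_add e1 e2
      _ = (a • f + b • ν) x := by simp
      _ ≤ ‖(a • f + b • ν) x‖ := le_abs_self _
      _ ≤ ‖a • f + b • ν‖ * 1 := (a • f + b • ν).le_opNorm_of_le hx
      _ = _ := mul_one _
  refine le_of_forall_pos_le_add fun δ hδ => ?_
  have hpos : 0 < |a| + |b| + 1 := by positivity
  have := main (δ / (|a| + |b| + 1)) (by positivity)
  have h2 : (|a| + |b| + 1) * (δ / (|a| + |b| + 1)) = δ := by field_simp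
  have h3 : 0 < δ / (|a| + |b| + 1) := by positivity
  nlinarith

lemma nu_not_attain (ν : CI →L[ℝ] ℝ) (p : ℕ → Set.Icc (0:ℝ) 1)
    (hp : ∃ z, Tendsto p atTop (𝓝 z))
    (hν : ∀ x : CI, HasSum (fun n => (1/2:ℝ)^n * ((-1)^n * x (p n))) (ν x))
    (x : CI) (hx : ‖x‖ ≤ 1) (τ : ℝ) (hτ : |τ| = 1) : ν x ≠ τ * 2 := by
  intro heq
  have hττ : τ * τ = 1 := by rw [← abs_mul_abs_self, hτ, one_mul]
  have hx' : ∀ q, |x q| ≤ 1 := fun q => (x.norm_coe_le_norm q).trans hx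
  have hsum := hasSum_two.sub ((hν x).mul_left τ)
  rw [heq, ← mul_assoc, hττ, one_mul, sub_self] at hsum
  have hle : ∀ n, τ * ((-1)^n * x (p n)) ≤ 1 := fun n => by
    refine (le_abs_self _).trans ?_
    rw [abs_mul, abs_mul, hτ, abs_pow]
    simpa using hx' (p n)
  have h0 := (hasSum_zero_iff_of_nonneg (fun n => by
    have := hle n
    have h2 : (0:ℝ) < (1/2)^n := by positivity
    change (0:ℝ) ≤ (1/2)^n - τ * ((1/2)^n * ((-1)^n * x (p n)))
    nlinarith)).1 hsum
  have h1 : ∀ n, τ * ((-1)^n * x (p n)) = 1 := fun n => by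
    have := congrFun h0 n
    have h2 : (0:ℝ) < (1/2)^n := by positivity
    simp only [Pi.zero_apply] at this
    have h3 : (1/2:ℝ)^n * (1 - τ * ((-1)^n * x (p n))) = 0 := by linarith
    rcases mul_eq_zero.1 h3 with h | h
    · exact absurd h h2.ne'
    · linarith
  have hneg : ∀ n, x (p n) * x (p (n+1)) = -1 := fun n => by
    have a1 := h1 n
    have a2 := h1 (n+1)
    have : ((-1:ℝ)^n) * (-1)^n = 1 := by rw [← mul_pow]; simp
    have h4 : (τ * ((-1)^n * x (p n))) * (τ * ((-1)^(n+1) * x (p (n+1)))) = 1 := by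
      rw [a1, a2, one_mul]
    have h5 : (τ * ((-1)^n * x (p n))) * (τ * ((-1)^(n+1) * x (p (n+1))))
      = - ((τ * τ) * ((-1)^n * (-1)^n) * (x (p n) * x (p (n+1)))) := by ring
    rw [h5, hττ, this] at h4
    linarith
  obtain ⟨z, hz⟩ := hp
  have l1 : Tendsto (fun n => x (p n)) atTop (𝓝 (x z)) := (x.continuous.tendsto z).comp hz
  have l2 := l1.mul (l1.comp (tendsto_add_atTop_nat 1))
  have l3 : Tendsto (fun _ : ℕ => (-1:ℝ)) atTop (𝓝 (x z * x z)) := by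
    refine l2.congr fun n => ?_
    exact hneg n
  have := tendsto_nhds_unique l3 tendsto_const_nhds
  nlinarith [mul_self_nonneg (x z)]

lemma hasBS_eq_zero (f : CI →L[ℝ] ℝ) (h : HasBS f) : f = 0 := by
  by_contra hf
  have hn : 0 < ‖f‖ := gen_norm_pos f hf
  obtain ⟨p, hinj, hlim, hg⟩ := exists_seq f
  obtain ⟨ν, hν⟩ := exists_nu p
  obtain ⟨x, hx, hfx, ho⟩ := h.2 ((2 / ‖f‖) • f + ν) (by
    intro t
    have h1 := norm_lower f ν p hinj hg hν (1 + t * (2 / ‖f‖)) t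
    have h2 : f + t • ((2 / ‖f‖) • f + ν) = (1 + t * (2 / ‖f‖)) • f + t • ν := by
      module
    rw [h2]
    refine le_trans ?_ h1
    have h3 : |1 + t * (2 / ‖f‖)| * ‖f‖ = |‖f‖ + t * 2| := by
      rw [← abs_of_pos hn, ← abs_mul, abs_of_pos hn]
      congr 1
      field_simp
    rw [h3]
    rw [show |t| * 2 = |t * 2| by rw [abs_mul]; simp]
    have h4 := le_abs_self (‖f‖ + t * 2)
    have h5 := neg_abs_le (t * 2)
    linarith)
  have hfx0 : f x ≠ 0 := by
    intro h0
    rw [h0, norm_zero] at hfx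
    linarith
  have hgx : ((2 / ‖f‖) • f + ν) x = 0 := by
    by_contra hne
    have := ho (-(f x / ((2 / ‖f‖) • f + ν) x))
    rw [smul_eq_mul, neg_mul, div_mul_cancel₀ _ hne, add_neg_cancel, norm_zero] at this
    exact hfx0 (norm_le_zero_iff.1 this)
  refine nu_not_attain ν p hlim hν x hx.le (-(f x / ‖f‖)) ?_ ?_
  · rw [abs_neg, abs_div, abs_of_pos hn, ← Real.norm_eq_abs, hfx, div_self hn.ne']
  · simp only [ContinuousLinearMap.add_apply, ContinuousLinearMap.smul_apply, smul_eq_mul] at hgx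
    linear_combination hgx

/-- The set of functionals on `C([0,1],ℝ)` with the Bhatia-Semrl property is not weak-* dense
in the dual: there is a nonempty weak-* open set containing no functional with the
Bhatia-Semrl property. -/
theorem not_weakStarDense_hasBS_C01 :
    (¬ Dense (⇑(StrongDual.toWeakDual (𝕜 := ℝ) (E := C(Set.Icc (0:ℝ) 1, ℝ))) ''
      {f : C(Set.Icc (0:ℝ) 1, ℝ) →L[ℝ] ℝ | HasBS f})) ∧
      ∃ U : Set (WeakDual ℝ C(Set.Icc (0:ℝ) 1, ℝ)), IsOpen U ∧ U.Nonempty ∧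
        ∀ f : C(Set.Icc (0:ℝ) 1, ℝ) →L[ℝ] ℝ, HasBS f →
          StrongDual.toWeakDual f ∉ U := by
  have key : ∃ U : Set (WeakDual ℝ C(Set.Icc (0:ℝ) 1, ℝ)), IsOpen U ∧ U.Nonempty ∧
        ∀ f : C(Set.Icc (0:ℝ) 1, ℝ) →L[ℝ] ℝ, HasBS f →
          StrongDual.toWeakDual f ∉ U := by
    refine ⟨{φ | φ (1 : C(Set.Icc (0:ℝ) 1, ℝ)) ≠ 0}, ?_, ?_, ?_⟩
    · exact isOpen_ne_fun (WeakDual.eval_continuous _) continuous_const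
    · refine ⟨StrongDual.toWeakDual (ContinuousMap.evalCLM ℝ (⟨0, by simp⟩ : Set.Icc (0:ℝ) 1)), ?_⟩
      simp
    · intro f hf hU
      rw [hasBS_eq_zero f hf] at hU
      exact hU rfl
  refine ⟨fun hd => ?_, key⟩
  obtain ⟨U, hU, hne, hno⟩ := key
  obtain ⟨_, hφ, f, hf, rfl⟩ := hd.inter_open_nonempty U hU hne
  exact hno f hf hφ
end
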